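/- For a nonnegative integer k and parameters a₂, a₃, b₁, b₂ such that both sides are defined, the terminating ₃F₂ at unit argument satisfies the transformation ₃F₂(−k, a₂, a₃; b₁, b₂ | 1) = ((b₂−a₂)_k / (b₂)_k) · ₃F₂(−k, a₂, b₁−a₃; b₁, a₂−k−b₂+1 | 1). -/

import Mathlib

noncomputable def pochC (p : ℂ) (k : ℕ) : ℂ := (ascPochhammer ℂ k).eval p

open Finset in
theorem sum_antidiagonal_fst_eq_sum_antidiagonal_snd (n : ℕ) (f : ℕ → ℕ → ℕ → ℂ) :
    ∑ p ∈ antidiagonal n, ∑ q ∈ antidiagonal p.1, f q.1 q.2 p.2 =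
      ∑ p ∈ antidiagonal n, ∑ q ∈ antidiagonal p.2, f p.1 q.1 q.2 := by
  rw [sum_sigma', sum_sigma']
  refine sum_nbij' (fun x ↦ ⟨(x.2.1, x.2.2 + x.1.2), (x.2.2, x.1.2)⟩)
    (fun x ↦ ⟨(x.1.1 + x.2.1, x.2.2), (x.1.1, x.2.1)⟩) ?_ ?_ ?_ ?_ ?_
  all_goals
    rintro ⟨⟨a, b⟩, ⟨c, d⟩⟩ h
    simp only [mem_sigma, HasAntidiagonal.mem_antidiagonal] at h ⊢
    try grind

theorem pochC_zero (x : ℂ) : pochC x 0 = 1 := by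
  simp [pochC]

theorem pochC_succ (x : ℂ) (n : ℕ) : pochC x (n + 1) = pochC x n * (x + n) := by
  simp [pochC, ascPochhammer_succ_eval]

theorem pochC_succ_left (x : ℂ) (n : ℕ) : pochC x (n + 1) = x * pochC (x + 1) n := by
  simp [pochC, ascPochhammer_succ_left]

theorem pochC_add (x : ℂ) (m n : ℕ) : pochC x (m + n) = pochC x m * pochC (x + m) n := by
  simp [pochC, ← ascPochhammer_mul]

theorem pochC_one (n : ℕ) : pochC 1 n = n.factorial := by
  simp [pochC]

/-- Reversing the order of the factors. -/
theorem pochC_neg (x : ℂ) (n : ℕ) : pochC (-x) n = (-1) ^ n * pochC (x - n + 1) n := by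
  induction n with
  | zero => simp [pochC_zero]
  | succ n ih =>
    rw [pochC_succ, ih, pochC_succ_left]
    push_cast
    ring_nf

theorem pochC_neg_natCast_add (m l : ℕ) :
    pochC (-((m + l : ℕ) : ℂ)) m = (-1) ^ m * ((m + l).factorial / l.factorial) := by
  have h := pochC_add 1 l m
  rw [pochC_one, pochC_one] at h
  have hl : (l.factorial : ℂ) ≠ 0 := mod_cast l.factorial_ne_zero
  rw [pochC_neg, add_comm m l, h, mul_div_cancel_left₀ _ hl]
  push_cast
  ring_nf

theorem pochC_add_eq_mul_reflect (x : ℂ) (m l : ℕ) :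
    pochC x (m + l) = (-1) ^ m * pochC (1 - x - (m + l : ℕ)) m * pochC x l := by
  have h := pochC_neg (x + l + m - 1) m
  rw [show x + l + m - 1 - m + 1 = x + l by ring] at h
  rw [show 1 - x - (m + l : ℕ) = -(x + l + m - 1) by push_cast; ring, h, add_comm m l,
    pochC_add, ← mul_assoc, ← mul_pow]
  simp [mul_comm]

open Finset in
/-- The Chu-Vandermonde identity, as a binomial theorem for rising factorials. -/
theorem sum_choose_mul_pochC_mul_pochC (x y : ℂ) (n : ℕ) :
    ∑ p ∈ antidiagonal n, (n.choose p.1 : ℂ) * (pochC x p.1 * pochC y p.2) =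
      pochC (x + y) n := by
  induction n with
  | zero => simp [pochC_zero]
  | succ n ih =>
    rw [sum_antidiagonal_choose_succ_mul (fun i j ↦ pochC x i * pochC y j), pochC_succ, ← ih,
      sum_mul, ← sum_add_distrib]
    refine sum_congr rfl fun p hp ↦ ?_
    obtain rfl := HasAntidiagonal.mem_antidiagonal.mp hp
    rw [pochC_succ, pochC_succ, Nat.choose_symm_add]
    push_cast
    ring

open Finset in
/-- The Chu-Vandermonde evaluation of a terminating `₂F₁` at `1`, with denominators cleared. -/
theorem sum_choose_mul_neg_one_pow_mul_pochC (b c : ℂ) (n : ℕ) :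
    ∑ p ∈ antidiagonal n,
        (n.choose p.1 : ℂ) * ((-1) ^ p.1 * pochC c p.1 * pochC (b + p.1) p.2) =
      pochC (b - c) n := by
  induction n generalizing b with
  | zero => simp [pochC_zero]
  | succ n ih =>
    rw [sum_antidiagonal_choose_succ_mul
      (fun i j ↦ (-1) ^ i * pochC c i * pochC (b + i) j), pochC_succ_left,
      show b - c + 1 = b + 1 - c by ring, ← ih, mul_sum, ← sum_add_distrib]
    refine sum_congr rfl fun p hp ↦ ?_
    obtain rfl := HasAntidiagonal.mem_antidiagonal.mp hp
    rw [pochC_succ_left, pochC_succ, Nat.choose_symm_add]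
    push_cast
    rw [show b + p.1 + 1 = b + 1 + p.1 by ring, show b + (p.1 + 1) = b + 1 + p.1 by ring]
    ring

theorem choose_eq_factorial_mul (i j : ℕ) :
    ((i + j).choose i : ℂ) = (i + j).factorial * (1 / (i.factorial * j.factorial)) := by
  rw [Nat.cast_add_choose]
  ring

open Finset in
theorem sum_pochC_div_factorial_mul (x y : ℂ) (n : ℕ) :
    ∑ p ∈ antidiagonal n, pochC x p.1 / p.1.factorial * (pochC y p.2 / p.2.factorial) =
      pochC (x + y) n / n.factorial := by
  have hn : (n.factorial : ℂ) ≠ 0 := mod_cast n.factorial_ne_zero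
  rw [← sum_choose_mul_pochC_mul_pochC, eq_div_iff hn, sum_mul]
  refine sum_congr rfl fun p hp ↦ ?_
  obtain rfl := HasAntidiagonal.mem_antidiagonal.mp hp
  rw [choose_eq_factorial_mul]
  ring

open Finset in
theorem pochC_sub_div_factorial (b c : ℂ) (n : ℕ) :
    pochC (b - c) n / n.factorial =
      ∑ p ∈ antidiagonal n,
        (-1) ^ p.1 * pochC c p.1 / p.1.factorial * (pochC (b + p.1) p.2 / p.2.factorial) := by
  have hn : (n.factorial : ℂ) ≠ 0 := mod_cast n.factorial_ne_zero
  rw [← sum_choose_mul_neg_one_pow_mul_pochC, div_eq_iff hn, sum_mul]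
  refine sum_congr rfl fun p hp ↦ ?_
  obtain rfl := HasAntidiagonal.mem_antidiagonal.mp hp
  rw [choose_eq_factorial_mul]
  ring

open Finset in
/-- The `₃F₂` transformation in symmetric form, with the factor `k!` removed. -/
theorem sum_pochC_transformation (k : ℕ) (a c b d : ℂ) (hb : ∀ m ≤ k, pochC b m ≠ 0)
    (hd : ∀ m ≤ k, pochC d m ≠ 0) :
    ∑ p ∈ antidiagonal k, pochC a p.1 / pochC b p.1 * (pochC (b - c) p.1 / p.1.factorial) *
        (pochC (d - a) p.2 / p.2.factorial) =
      pochC d k * ∑ p ∈ antidiagonal k, (-1) ^ p.1 * pochC a p.1 * pochC c p.1 /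
        (pochC b p.1 * pochC d p.1 * p.1.factorial * p.2.factorial) := by
  set A : ℕ → ℂ := fun j ↦ (-1) ^ j * pochC a j * pochC c j / (pochC b j * j.factorial)
  calc
    _ = ∑ p ∈ antidiagonal k, ∑ q ∈ antidiagonal p.1,
          A q.1 * (pochC (a + q.1) q.2 / q.2.factorial *
            (pochC (d - a) p.2 / p.2.factorial)) := by
      refine sum_congr rfl fun p hp ↦ ?_
      rw [pochC_sub_div_factorial, mul_sum, sum_mul]
      refine sum_congr rfl fun q hq ↦ ?_
      have hpk := HasAntidiagonal.antidiagonal.fst_le hp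
      have hbp := hb _ hpk
      rw [← HasAntidiagonal.mem_antidiagonal.mp hq, pochC_add] at hbp ⊢
      have hbq := left_ne_zero_of_mul hbp
      have hbq' := right_ne_zero_of_mul hbp
      rw [pochC_add]
      simp only [A]
      field_simp
    _ = ∑ p ∈ antidiagonal k, A p.1 * (pochC (d + p.1) p.2 / p.2.factorial) := by
      rw [sum_antidiagonal_fst_eq_sum_antidiagonal_snd k
        (fun j i l ↦ A j * (pochC (a + j) i / i.factorial * (pochC (d - a) l / l.factorial)))]
      refine sum_congr rfl fun p _ ↦ ?_
      rw [← mul_sum, sum_pochC_div_factorial_mul, show a + p.1 + (d - a) = d + p.1 by ring]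
    _ = _ := by
      rw [mul_sum]
      refine sum_congr rfl fun p hp ↦ ?_
      have hdp := hd _ (HasAntidiagonal.antidiagonal.fst_le hp)
      rw [← HasAntidiagonal.mem_antidiagonal.mp hp, pochC_add]
      simp only [A]
      field_simp

/-- Transformation of a terminating `₃F₂` at unit argument. -/
theorem threeF2_transformation (k : ℕ) (a₂ a₃ b₁ b₂ : ℂ)
    (hb₁ : ∀ m : ℕ, m ≤ k → pochC b₁ m ≠ 0)
    (hb₂ : ∀ m : ℕ, m ≤ k → pochC b₂ m ≠ 0)
    (hb₃ : ∀ m : ℕ, m ≤ k → pochC (a₂ - (k : ℂ) - b₂ + 1) m ≠ 0) :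
    (∑ m ∈ Finset.range (k + 1),
        pochC (-(k : ℂ)) m * pochC a₂ m * pochC a₃ m /
          (pochC b₁ m * pochC b₂ m * (m.factorial : ℂ)))
      = pochC (b₂ - a₂) k / pochC b₂ k *
        ∑ m ∈ Finset.range (k + 1),
          pochC (-(k : ℂ)) m * pochC a₂ m * pochC (b₁ - a₃) m /
            (pochC b₁ m * pochC (a₂ - (k : ℂ) - b₂ + 1) m * (m.factorial : ℂ)) := by
  rw [div_mul_eq_mul_div, eq_div_iff (hb₂ k le_rfl), mul_comm _ (pochC b₂ k),
    ← Finset.Nat.sum_antidiagonal_eq_sum_range_succ_mk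
      (fun p : ℕ × ℕ ↦ pochC (-(k : ℂ)) p.1 * pochC a₂ p.1 * pochC a₃ p.1 /
          (pochC b₁ p.1 * pochC b₂ p.1 * (p.1.factorial : ℂ))),
    ← Finset.Nat.sum_antidiagonal_eq_sum_range_succ_mk
      (fun p : ℕ × ℕ ↦ pochC (-(k : ℂ)) p.1 * pochC a₂ p.1 * pochC (b₁ - a₃) p.1 /
          (pochC b₁ p.1 * pochC (a₂ - (k : ℂ) - b₂ + 1) p.1 * (p.1.factorial : ℂ)))]
  have key := congrArg (fun z ↦ (k.factorial : ℂ) * z)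
    (sum_pochC_transformation k a₂ a₃ b₁ b₂ hb₁ hb₂)
  simp only [mul_left_comm _ (pochC b₂ k), Finset.mul_sum] at key ⊢
  refine Eq.trans ?_ (key.symm.trans ?_)
  · refine Finset.sum_congr rfl fun p hp ↦ ?_
    obtain rfl := Finset.HasAntidiagonal.mem_antidiagonal.mp hp
    rw [pochC_neg_natCast_add]
    ring
  · refine Finset.sum_congr rfl fun p hp ↦ ?_
    have h₃ := hb₃ _ (Finset.HasAntidiagonal.antidiagonal.fst_le hp)
    obtain rfl := Finset.HasAntidiagonal.mem_antidiagonal.mp hp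
    rw [pochC_neg_natCast_add, pochC_add_eq_mul_reflect (b₂ - a₂),
      show 1 - (b₂ - a₂) - ((p.1 + p.2 : ℕ) : ℂ) = a₂ - ((p.1 + p.2 : ℕ) : ℂ) - b₂ + 1 by ring]
    rcases neg_one_pow_eq_or ℂ p.1 with h | h <;> rw [h] <;> field_simp
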